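/- arXiv:1612.03624 — 3 statements merged into one kernel-verified Lean document; each statement's English description precedes it below -/
import Mathlib

section
/- Let T be a commutative automorphic Lie triple system over a field of characteristic zero and let a', b' ∈ T. For every n ≥ 0, the map D := (R_{a',a'})ⁿ ∘ R_{a',b'} is a derivation of T: for all a, b, c ∈ T, D([a,b,c]) = [D(a),b,c] + [a,D(b),c] + [a,b,D(c)]. -/
/-- The identity obtained from skew-symmetry of commutators of right multiplications. -/
theorem aux_N {K T : Type*} [Field K] [AddCommGroup T] [Module K T]
    (br : T →ₗ[K] T →ₗ[K] T →ₗ[K] T)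
    (skew : ∀ a b c : T, br a b c = - br b a c)
    (ca : ∀ a b c a' b' : T,
      br (br a b c) a' b' = br (br a a' b') b c + br a (br b a' b') c + br a b (br c a' b'))
    (x c a b d : T) :
    br x c (br d a b) + br x c (br b a d) + br x a (br d c b) + br x a (br b c d) = 0 := by
  have S : ∀ c a b d : T, br x (br c a b) d + br x c (br d a b) + br x (br a c d) b
      + br x a (br b c d) = 0 := by
    intro c a b d
    have h1 := ca x c d a b
    have h2 := ca x a b c d
    linear_combination (norm := module) (-1 : K) • h1 + (-1 : K) • h2
  have h1 := S c a b d
  have h2 := S a c b d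
  have e1 : br x (br c a b) d = - br x (br a c b) d := by rw [skew c a b]; simp
  have e2 : br x (br a c d) b = - br x (br c a d) b := by rw [skew a c d]; simp
  linear_combination (norm := module) (1 : K) • h1 + (1 : K) • h2 - (1 : K) • e1 - (1 : K) • e2

/-- Vanishing of the cross terms. -/
theorem aux_van {K T : Type*} [Field K] [CharZero K] [AddCommGroup T] [Module K T]
    (br : T →ₗ[K] T →ₗ[K] T →ₗ[K] T)
    (skew : ∀ a b c : T, br a b c = - br b a c)
    (jacobi : ∀ a b c : T, br a b c + br b c a + br c a b = 0)
    (ca : ∀ a b c a' b' : T,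
      br (br a b c) a' b' = br (br a a' b') b c + br a (br b a' b') c + br a b (br c a' b'))
    (a b : T) :
    (∀ x y z : T, br (br x a a) y (br z a b) = 0) ∧
    (∀ x y z : T, br (br x a b) y (br z a a) = 0) ∧
    (∀ x : T, br (br x a b) a a = br (br x a a) a b) := by
  have N := aux_N br skew ca
  have sk1 : ∀ p q r s t : T, br p q (br r s t) + br q p (br r s t) = 0 := by
    intro p q r s t
    rw [skew p q]; simp
  have sk2 : ∀ p q r s t : T, br p q (br r s t) + br p q (br s r t) = 0 := by
    intro p q r s t
    rw [skew r s]; simp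
  have jc : ∀ p q r s t : T,
      br p q (br r s t) + br p q (br s t r) + br p q (br t r s) = 0 := by
    intro p q r s t
    rw [← map_add, ← map_add, jacobi, map_zero]
  have diag : ∀ p q : T, br p p q = 0 := by
    intro p q
    have h := skew p p q
    have : (2 : K) • br p p q = 0 := by linear_combination (norm := module) (1 : K) • h
    exact (smul_eq_zero.mp this).resolve_left two_ne_zero
  -- `[x, a, [z, a, a]] = 0`
  have R0 : ∀ x z : T, br x a (br z a a) = 0 := by
    intro x z
    have h := N x a a z a
    rw [diag a z, map_zero] at h
    have : (2 : K) • br x a (br z a a) = 0 := by linear_combination (norm := module) (1 : K) • h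
    exact (smul_eq_zero.mp this).resolve_left two_ne_zero
  -- `[x, y, [z, a, a]]` is alternating in `y, z`
  have alt : ∀ x y z : T, br x y (br z a a) = - br x z (br y a a) := by
    intro x y z
    have h := N x y z a a
    have e1 := sk2 x y a z a
    have e2 := sk2 x z a y a
    have : (2 : K) • (br x y (br z a a) + br x z (br y a a)) = 0 := by
      linear_combination (norm := module) (-1 : K) • h + (2 : K) • e1 + (2 : K) • e2
    exact eq_neg_of_add_eq_zero_left ((smul_eq_zero.mp this).resolve_left two_ne_zero)
  have comm : ∀ x : T, br (br x a b) a a = br (br x a a) a b := by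
    intro x
    have h := ca x a b a a
    rw [diag a a, R0] at h
    simpa using h
  have five : ∀ m : T, (∀ x, br x a m = 0) → ∀ y z : T,
      (3 : K) • br y a (br b z m) + (2 : K) • br y z (br m a b) = 0 ∧
      (3 : K) • br m y (br z a b) - (2 : K) • br y z (br m a b) = 0 := by
    intro m hm y z
    have H : ∀ p q r s t : T, s = a → t = m → br p q (br r s t) = 0 := by
      rintro p q r s t rfl rfl
      rw [hm, map_zero]
    have H1 := H y z b a m rfl rfl
    have H2 := H y b z a m rfl rfl
    constructor
    · linear_combination (norm := module) (1:K) • N y a z m b + (1:K) • H1 + (2:K) • jc y a m b z + (-2:K) • sk2 y a m z b + (-1:K) • sk2 y a m b z + (1:K) • jc y a m z b + (3:K) • H2 + (-1:K) • sk2 y b a z m + (-1:K) • N y a b m z + (1:K) • N y z b m a + (-1:K) • jc y b m z a + (1:K) • sk2 y b m a z + (1:K) • sk2 y z m b a + (-1:K) • jc y z m a b + (-2:K) • jc y z m b a + (2:K) • sk2 y z m a b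
    · linear_combination (norm := module) (2:K) • H1 + (-2:K) • sk2 y z m a b + (-3:K) • sk1 m y a z b + (3:K) • sk2 m y a z b + (-1:K) • sk2 y m a b z + (1:K) • jc y m a z b + (-2:K) • sk2 y m z b a + (2:K) • N y z b m a + (-2:K) • jc y b m a z + (1:K) • sk2 y b m z a + (1:K) • N y m b a z + (2:K) • sk2 y b m a z + (3:K) • H2 + (-3:K) • jc y b m z a + (-2:K) • sk2 y z a b m + (2:K) • N y m z a b + (-2:K) • sk2 y z m b a
  have hP : ∀ x y z : T, br (br x a b) y (br z a a) = br y z (br (br x a a) a b) := by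
    intro x y z
    rw [← comm, skew _ y, alt y z, skew y]
  have key : ∀ x y z : T, br x y (br (br z a a) a b) = (3 : K) • br x z (br (br y a a) a b) := by
    intro x y z
    have h1 := ca x y (br z a a) a b
    have h2 := ca x a b y (br z a a)
    have h3 := (five (br z a a) (fun w => R0 w z) x y).1
    have h4 : br a y (br z a a) = 0 := by rw [skew, R0, neg_zero]
    rw [h4] at h2
    simp only [map_zero, LinearMap.zero_apply] at h2
    have h5 : br x (br y a b) (br z a a) = - br x z (br (br y a a) a b) := by
      rw [skew, hP]
    linear_combination (norm := module) (-3 : K) • h1 + (-3 : K) • h2 + (-3 : K) • h5 + (-1 : K) • h3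
  have P0 : ∀ x y z : T, br x y (br (br z a a) a b) = 0 := by
    intro x y z
    have h1 := key x y z
    have h2 := key x z y
    have : (8 : K) • br x y (br (br z a a) a b) = 0 := by
      linear_combination (norm := module) (-1 : K) • h1 + (-3 : K) • h2
    exact (smul_eq_zero.mp this).resolve_left (by norm_num)
  refine ⟨?_, ?_, comm⟩
  · intro x y z
    have h := (five (br x a a) (fun w => R0 w x) y z).2
    rw [P0, smul_zero, sub_zero] at h
    exact (smul_eq_zero.mp h).resolve_left (by norm_num)
  · intro x y z
    rw [hP, P0]

/-- For every `n ≥ 0`, the map `D = (R_{a',a'})ⁿ ∘ R_{a',b'}` is a derivation of a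
commutative automorphic Lie triple system over a field of characteristic zero. -/
theorem stmt_8 {K T : Type*} [Field K] [CharZero K] [AddCommGroup T] [Module K T]
    (br : T →ₗ[K] T →ₗ[K] T →ₗ[K] T)
    (skew : ∀ a b c : T, br a b c = - br b a c)
    (jacobi : ∀ a b c : T, br a b c + br b c a + br c a b = 0)
    (ca : ∀ a b c a' b' : T,
      br (br a b c) a' b' = br (br a a' b') b c + br a (br b a' b') c + br a b (br c a' b'))
    (a' b' : T) :
    ∀ n : ℕ, ∀ a b c : T,
      ((fun x : T => br x a' a')^[n] ∘ fun x : T => br x a' b') (br a b c)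
        = br (((fun x : T => br x a' a')^[n] ∘ fun x : T => br x a' b') a) b c
          + br a (((fun x : T => br x a' a')^[n] ∘ fun x : T => br x a' b') b) c
          + br a b (((fun x : T => br x a' a')^[n] ∘ fun x : T => br x a' b') c) := by
  obtain ⟨v1, v2, comm⟩ := aux_van br skew jacobi ca a' b'
  have hD : ∀ n : ℕ, ∀ x : T,
      (∃ y, (fun x : T => br x a' a')^[n] (br x a' b') = br y a' b') := by
    intro n
    induction n with
    | zero => intro x; exact ⟨x, rfl⟩
    | succ k ih =>
      intro x
      obtain ⟨y, hy⟩ := ih x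
      refine ⟨br y a' a', ?_⟩
      rw [Function.iterate_succ_apply', hy]
      exact comm y
  intro n
  induction n with
  | zero => intro a b c; exact ca a b c a' b'
  | succ k ih =>
    intro a b c
    have h := ih a b c
    simp only [Function.comp_apply, Function.iterate_succ_apply'] at h ⊢
    rw [h]
    obtain ⟨p, hp⟩ := hD k a
    obtain ⟨q, hq⟩ := hD k b
    obtain ⟨r, hr⟩ := hD k c
    rw [hp, hq, hr]
    -- the six cross terms vanish
    have u1 : ∀ x y z : T, br x (br y a' a') (br z a' b') = 0 := by
      intro x y z; rw [skew, v1, neg_zero]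
    have u2 : ∀ x y z : T, br x (br y a' b') (br z a' a') = 0 := by
      intro x y z; rw [skew, v2, neg_zero]
    have u1' : ∀ x y z : T, br z (br x a' a') (br y a' b') = 0 := fun x y z => u1 z x y
    have u3 : ∀ x y z : T, br (br x a' a') (br y a' b') z = 0 := by
      intro x y z
      have j := jacobi (br x a' a') (br y a' b') z
      rw [v2, u1'] at j
      simpa using j
    have u4 : ∀ x y z : T, br (br x a' b') (br y a' a') z = 0 := by
      intro x y z; rw [skew, u3, neg_zero]
    simp only [map_add, LinearMap.add_apply]
    rw [ca (br p a' b') b c a' a', ca a (br q a' b') c a' a', ca a b (br r a' b') a' a']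
    simp only [u1, u2, u3, u4, v1, v2, add_zero, zero_add]
end

section
/- Every finite-dimensional commutative automorphic Lie triple system T over a field of characteristic zero is solvable: defining the derived series by T⁽¹⁾ := span{[x,y,z] : x,y,z ∈ T} and T⁽ⁱ⁺¹⁾ := span{[x,y,z] : x ∈ T, y,z ∈ T⁽ⁱ⁾}, there exists n ≥ 1 with T⁽ⁿ⁾ = 0. -/
/-- The derived series of a triple system: `D 0 = ⊤`, and
`D (i+1) = span {[x,y,z] : x ∈ T, y, z ∈ D i}`, so that `D 1` is the span of all brackets. -/
def tripleDerivedSeries {K T : Type*} [Field K] [AddCommGroup T] [Module K T]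
    (br : T →ₗ[K] T →ₗ[K] T →ₗ[K] T) : ℕ → Submodule K T
  | 0 => ⊤
  | n + 1 => Submodule.span K
      {w : T | ∃ x : T, ∃ y ∈ tripleDerivedSeries br n, ∃ z ∈ tripleDerivedSeries br n,
        w = br x y z}

/-- The axioms of a commutative automorphic Lie triple system. -/
structure IsCALTS {K T : Type*} [Field K] [AddCommGroup T] [Module K T]
    (br : T →ₗ[K] T →ₗ[K] T →ₗ[K] T) : Prop where
  skew : ∀ a b c : T, br a b c = - br b a c
  jacobi : ∀ a b c : T, br a b c + br b c a + br c a b = 0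
  ca : ∀ a b c a' b' : T,
      br (br a b c) a' b' = br (br a a' b') b c + br a (br b a' b') c + br a b (br c a' b')

/-- The space of derivations of a triple product. -/
def tripleDer {K T : Type*} [Field K] [AddCommGroup T] [Module K T]
    (br : T →ₗ[K] T →ₗ[K] T →ₗ[K] T) : Submodule K (T →ₗ[K] T) where
  carrier := {X | ∀ a b c, X (br a b c) = br (X a) b c + br a (X b) c + br a b (X c)}
  add_mem' := by
    intro X Y hX hY a b c
    simp only [LinearMap.add_apply, hX a b c, hY a b c, map_add]
    abel
  zero_mem' := by intro a b c; simp
  smul_mem' := by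
    intro r X hX a b c
    simp only [LinearMap.smul_apply, hX a b c, map_smul, smul_add]

set_option linter.unusedSectionVars false
set_option linter.unusedSimpArgs false

section
variable {K T : Type*} [Field K] [CharZero K] [AddCommGroup T] [Module K T]
    {br : T →ₗ[K] T →ₗ[K] T →ₗ[K] T}

theorem IsCALTS.left_mem (h : IsCALTS br) (a b : T) : br a b ∈ tripleDer br := by
  have e : ∀ x, br a b x = br x b a - br x a b := by
    intro x
    have h1 := h.jacobi a b x
    have h2 := h.skew b x a
    rw [h2] at h1
    rw [← sub_eq_zero]
    rw [← h1]; abel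
  intro x y z
  rw [e, h.ca x y z b a, h.ca x y z a b, e x, e y, e z]
  simp only [map_sub, LinearMap.sub_apply]
  abel

theorem IsCALTS.right_mem (h : IsCALTS br) (b c : T) : (br.flip b).flip c ∈ tripleDer br := by
  intro x y z
  simp only [LinearMap.flip_apply]
  exact h.ca x y z b c

/-- The standard embedding, with all derivations as the even part. -/
def StdEmb (_h : IsCALTS br) : Type _ := T × tripleDer br

namespace StdEmb
variable (h : IsCALTS br)

instance : AddCommGroup (StdEmb h) := inferInstanceAs (AddCommGroup (T × tripleDer br))
instance : Module K (StdEmb h) := inferInstanceAs (Module K (T × tripleDer br))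
instance [FiniteDimensional K T] : FiniteDimensional K (StdEmb h) :=
  inferInstanceAs (FiniteDimensional K (T × tripleDer br))

/-- Inner derivation. -/
def inn (a b : T) : tripleDer br := ⟨br a b, h.left_mem a b⟩

/-- Commutator of derivations. -/
def comm (X Y : tripleDer br) : tripleDer br :=
  ⟨X.1 ∘ₗ Y.1 - Y.1 ∘ₗ X.1, by
    intro a b c
    have hX' : ∀ a b c, X.1 (br a b c) = br (X.1 a) b c + br a (X.1 b) c + br a b (X.1 c) := X.2
    have hY' : ∀ a b c, Y.1 (br a b c) = br (Y.1 a) b c + br a (Y.1 b) c + br a b (Y.1 c) := Y.2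
    simp only [LinearMap.sub_apply, LinearMap.comp_apply, hX', hY',
      map_add, map_sub, LinearMap.add_apply]
    abel⟩

instance : Bracket (StdEmb h) (StdEmb h) where
  bracket u v := ((u.2.1 v.1 - v.2.1 u.1, inn h u.1 v.1 + comm u.2 v.2) : T × tripleDer br)

theorem ext' {u v : StdEmb h} (h1 : u.1 = v.1) (h2 : ∀ t, u.2.1 t = v.2.1 t) : u = v :=
  Prod.ext h1 (Subtype.ext (LinearMap.ext h2))

theorem lie_fst (u v : StdEmb h) : (⁅u, v⁆ : StdEmb h).1 = u.2.1 v.1 - v.2.1 u.1 := rfl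
theorem lie_snd (u v : StdEmb h) (t : T) : (⁅u, v⁆ : StdEmb h).2.1 t =
  br u.1 v.1 t + (u.2.1 (v.2.1 t) - v.2.1 (u.2.1 t)) := rfl
theorem add_fst (u v : StdEmb h) : (u + v).1 = u.1 + v.1 := rfl
theorem add_snd (u v : StdEmb h) (t : T) : (u + v).2.1 t = u.2.1 t + v.2.1 t := rfl
theorem zero_fst : (0 : StdEmb h).1 = 0 := rfl
theorem zero_snd (t : T) : (0 : StdEmb h).2.1 t = 0 := rfl
theorem smul_fst (r : K) (v : StdEmb h) : (r • v).1 = r • v.1 := rfl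
theorem smul_snd (r : K) (v : StdEmb h) (t : T) : (r • v).2.1 t = r • v.2.1 t := rfl
theorem der (u : StdEmb h) (a b c : T) :
    u.2.1 (br a b c) = br (u.2.1 a) b c + br a (u.2.1 b) c + br a b (u.2.1 c) := u.2.2 a b c

instance : LieRing (StdEmb h) where
  add_lie u v w := by
    apply ext'
    · simp only [lie_fst, add_fst, add_snd, map_add]; abel
    · intro t
      simp only [lie_snd, add_fst, add_snd, map_add, LinearMap.add_apply]; abel
  lie_add u v w := by
    apply ext'
    · simp only [lie_fst, add_fst, add_snd, map_add]; abel
    · intro t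
      simp only [lie_snd, add_fst, add_snd, map_add, LinearMap.add_apply]; abel
  lie_self u := by
    apply ext'
    · simp only [lie_fst, zero_fst, sub_self]
    · intro t
      simp only [lie_snd, zero_snd, sub_self, add_zero]
      have h0 := h.skew u.1 u.1 t
      have h1 : (2 : K) • br u.1 u.1 t = 0 := by
        rw [two_smul]; nth_rewrite 1 [h0]; simp
      exact (smul_eq_zero.mp h1).resolve_left two_ne_zero
  leibniz_lie u v w := by
    apply ext'
    · simp only [lie_fst, lie_snd, add_fst, map_sub]
      have h1 := h.jacobi u.1 v.1 w.1
      have h2 := h.skew w.1 u.1 v.1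
      rw [h2] at h1
      have h3 : br v.1 w.1 u.1 = br u.1 w.1 v.1 - br u.1 v.1 w.1 := by
        rw [← sub_eq_zero, ← h1]; abel
      rw [h3]; abel
    · intro t
      simp only [lie_fst, lie_snd, add_snd, map_sub, map_add, LinearMap.sub_apply, der]
      rw [h.skew (w.2.1 u.1) v.1]
      abel

instance : LieAlgebra K (StdEmb h) where
  lie_smul r u v := by
    apply ext'
    · simp only [lie_fst, smul_fst, smul_snd, map_smul, smul_sub]
    · intro t
      simp only [lie_snd, smul_fst, smul_snd, map_smul, LinearMap.smul_apply, smul_add, smul_sub]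

/-- The odd embedding. -/
def odd (a : T) : StdEmb h := ((a, 0) : T × tripleDer br)
/-- The even embedding. -/
def even (X : tripleDer br) : StdEmb h := ((0, X) : T × tripleDer br)

theorem odd_fst (a : T) : (odd h a).1 = a := rfl
theorem odd_snd (a t : T) : (odd h a).2.1 t = 0 := rfl
theorem even_fst (X : tripleDer br) : (even h X).1 = 0 := rfl
theorem even_snd (X : tripleDer br) (t : T) : (even h X).2.1 t = X.1 t := rfl

theorem odd_add (u v : T) : odd h (u + v) = odd h u + odd h v := by
  apply ext'
  · simp only [add_fst, odd_fst]
  · intro t; simp only [add_snd, odd_snd, add_zero]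

theorem odd_neg (u : T) : odd h (-u) = - odd h u := by
  rw [eq_neg_iff_add_eq_zero, ← odd_add, neg_add_cancel]; rfl

theorem decomp (u : StdEmb h) : u = odd h u.1 + even h u.2 := by
  apply ext'
  · simp only [add_fst, odd_fst, even_fst, add_zero]
  · intro t; simp only [add_snd, odd_snd, even_snd, zero_add]

theorem even_odd (X : tripleDer br) (a : T) : ⁅even h X, odd h a⁆ = odd h (X.1 a) := by
  apply ext'
  · simp only [lie_fst, even_fst, odd_fst, even_snd, odd_snd, sub_zero]
  · intro t
    simp only [lie_snd, even_fst, odd_fst, even_snd, odd_snd, map_zero, LinearMap.zero_apply,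
      sub_zero, add_zero]

theorem odd_odd (a b : T) : ⁅odd h a, odd h b⁆ = even h (inn h a b) := by
  apply ext'
  · simp only [lie_fst, even_fst, odd_fst, odd_snd, sub_zero]
  · intro t
    simp only [lie_snd, odd_fst, even_snd, odd_snd, sub_zero, add_zero]
    rfl

/-- The grading involution, as a function. -/
def thetaFun (u : StdEmb h) : StdEmb h := ((-u.1, u.2) : T × tripleDer br)

theorem thetaFun_fst (u : StdEmb h) : (thetaFun h u).1 = -u.1 := rfl
theorem thetaFun_snd (u : StdEmb h) (t : T) : (thetaFun h u).2.1 t = u.2.1 t := rfl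

theorem thetaFun_thetaFun (u : StdEmb h) : thetaFun h (thetaFun h u) = u := by
  apply ext'
  · simp only [thetaFun_fst, neg_neg]
  · intro t; simp only [thetaFun_snd]

/-- The grading automorphism. -/
def theta : StdEmb h ≃ₗ⁅K⁆ StdEmb h where
  toFun := thetaFun h
  invFun := thetaFun h
  left_inv := thetaFun_thetaFun h
  right_inv := thetaFun_thetaFun h
  map_add' u v := by
    apply ext'
    · simp only [thetaFun_fst, add_fst]; abel
    · intro t; simp only [thetaFun_snd, add_snd]
  map_smul' r u := by
    apply ext'
    · simp only [thetaFun_fst, smul_fst, RingHom.id_apply, smul_neg]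
    · intro t; simp only [thetaFun_snd, smul_snd, RingHom.id_apply]
  map_lie' := by
    intro u v
    change thetaFun h _ = ⁅thetaFun h u, thetaFun h v⁆
    apply ext'
    · simp only [lie_fst, thetaFun_fst, thetaFun_snd, map_neg]; abel
    · intro t
      simp only [lie_snd, thetaFun_fst, thetaFun_snd, map_neg, LinearMap.neg_apply, neg_neg]

theorem theta_odd (a : T) : theta h (odd h a) = - odd h a := by
  rw [← odd_neg]; rfl

theorem theta_even (X : tripleDer br) : theta h (even h X) = even h X := by
  change thetaFun h _ = _
  apply ext'
  · simp only [thetaFun_fst, even_fst, neg_zero]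
  · intro t; simp only [thetaFun_snd]

theorem killing_odd_even [FiniteDimensional K T] (a : T) (X : tripleDer br) :
    killingForm K (StdEmb h) (odd h a) (even h X) = 0 := by
  have e := LieAlgebra.killingForm_of_equiv_apply (theta h) (odd h a) (even h X)
  rw [theta_odd, theta_even, map_neg, LinearMap.neg_apply] at e
  linear_combination (-1 / 2 : K) * e

theorem killing_odd [FiniteDimensional K T] (a x y b : T) :
    killingForm K (StdEmb h) (odd h (br a x y)) (odd h b) = 0 := by
  set f : T → T → T → T → K := fun a x y b =>
    killingForm K (StdEmb h) (odd h (br a x y)) (odd h b) with hf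
  have odd_zero : odd h 0 = 0 := rfl
  have s12 : ∀ a x y b, f a x y b = - f x a y b := by
    intro a x y b
    simp only [hf]
    rw [h.skew, odd_neg, map_neg, LinearMap.neg_apply]
  have jac : ∀ a x y b, f a x y b + f x y a b + f y a x b = 0 := by
    intro a x y b
    simp only [hf]
    rw [← LinearMap.add_apply, ← map_add, ← LinearMap.add_apply, ← map_add, ← odd_add, ← odd_add,
      h.jacobi, odd_zero, map_zero, LinearMap.zero_apply]
  have s14 : ∀ a x y b, f a x y b = - f b x y a := by
    intro a x y b
    simp only [hf]
    have e : ∀ c, odd h (br c x y) = ⁅even h ⟨_, h.right_mem x y⟩, odd h c⁆ := by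
      intro c
      rw [even_odd]; rfl
    rw [e, e, LieModule.traceForm_apply_lie_apply', LieModule.traceForm_comm]
  change f a x y b = 0
  have j1 := jac a x y b
  have j2 := jac a x b y
  have j3 := jac y x b a
  have j4 := jac a y b x
  clear_value f
  clear hf
  grind

theorem odd_mem_radical [FiniteDimensional K T] (a x y : T) :
    odd h (br a x y) ∈ LieAlgebra.radical K (StdEmb h) := by
  apply LieAlgebra.killingCompl_top_le_radical
  rw [LieIdeal.mem_killingCompl]
  intro u _
  rw [decomp h u, map_add, LinearMap.add_apply, LieModule.traceForm_comm, killing_odd,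
    LieModule.traceForm_comm, killing_odd_even, add_zero]

/-- The odd embedding as a linear map. -/
def oddL : T →ₗ[K] StdEmb h := LinearMap.inl K T (tripleDer br)

theorem derived_le [FiniteDimensional K T] (n : ℕ) :
    tripleDerivedSeries br (n + 1) ≤
      ((LieAlgebra.derivedSeriesOfIdeal K (StdEmb h) n
        (LieAlgebra.radical K (StdEmb h))).toSubmodule).comap (oddL h) := by
  induction n with
  | zero =>
    rw [tripleDerivedSeries, Submodule.span_le]
    rintro _ ⟨x, y, -, z, -, rfl⟩
    exact odd_mem_radical h x y z
  | succ n ih =>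
    rw [tripleDerivedSeries, Submodule.span_le]
    rintro _ ⟨x, y, hy, z, hz, rfl⟩
    have hy' := ih hy
    have hz' := ih hz
    change odd h (br x y z) ∈ LieAlgebra.derivedSeriesOfIdeal K (StdEmb h) (n + 1)
        (LieAlgebra.radical K (StdEmb h))
    have e : odd h (br x y z) = ⁅⁅odd h x, odd h y⁆, odd h z⁆ := by
      rw [odd_odd, even_odd]; rfl
    rw [e, LieAlgebra.derivedSeriesOfIdeal_succ]
    exact LieSubmodule.lie_mem_lie (lie_mem_right K _ _ _ _ hy') hz'

end StdEmb
end

/-- Every finite-dimensional commutative automorphic Lie triple system over a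
field of characteristic zero is solvable. -/
theorem stmt_9 {K T : Type*} [Field K] [CharZero K] [AddCommGroup T] [Module K T]
    [FiniteDimensional K T]
    (br : T →ₗ[K] T →ₗ[K] T →ₗ[K] T)
    (skew : ∀ a b c : T, br a b c = - br b a c)
    (jacobi : ∀ a b c : T, br a b c + br b c a + br c a b = 0)
    (ca : ∀ a b c a' b' : T,
      br (br a b c) a' b' = br (br a a' b') b c + br a (br b a' b') c + br a b (br c a' b')) :
    ∃ n : ℕ, 1 ≤ n ∧ tripleDerivedSeries br n = ⊥ := by
  have h : IsCALTS br := ⟨skew, jacobi, ca⟩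
  obtain ⟨k, hk⟩ := LieAlgebra.IsSolvable.solvable K (LieAlgebra.radical K (StdEmb h))
  rw [LieIdeal.derivedSeries_eq_bot_iff] at hk
  refine ⟨k + 1, by omega, ?_⟩
  rw [eq_bot_iff]
  intro t ht
  have h1 := StdEmb.derived_le h k ht
  rw [hk] at h1
  have h2 : StdEmb.odd h t = 0 := h1
  exact congrArg Prod.fst h2
end

section
/- Let T be the K-linear span in 𝔸 of the set {a, b} ∪ {c·aⁱ·bʲ : i, j ≥ 0, i + j odd}, where c := a·b − b·a. Then [T,T,[T,T,T]] = 0 for the triple product [x,y,z] := [[x,y],z]: for all t₁, t₂, t₃, t₄, t₅ ∈ T one has [[t₁,t₂],[[t₃,t₄],t₅]] = 0 in 𝔸 (where [x,y] := xy − yx). -/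
noncomputable section

/-- The first generator of the free algebra on two generators. -/
def Agen (K : Type*) [Field K] : FreeAlgebra K (Fin 2) := FreeAlgebra.ι K 0

/-- The second generator of the free algebra on two generators. -/
def Bgen (K : Type*) [Field K] : FreeAlgebra K (Fin 2) := FreeAlgebra.ι K 1

/-- The relations `a·a·b = a·b·a` and `b·b·a = b·a·b`. -/
inductive ARel (K : Type*) [Field K] :
    FreeAlgebra K (Fin 2) → FreeAlgebra K (Fin 2) → Prop
  | aab : ARel K (Agen K * Agen K * Bgen K) (Agen K * Bgen K * Agen K)
  | bba : ARel K (Bgen K * Bgen K * Agen K) (Bgen K * Agen K * Bgen K)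

/-- The algebra `𝔸`: the quotient of the free unital associative `K`-algebra on two
generators `a`, `b` by the two-sided ideal generated by `a·a·b − a·b·a` and
`b·b·a − b·a·b`. -/
abbrev AAlg (K : Type*) [Field K] := RingQuot (ARel K)

/-- The image of the generator `a` in `𝔸`. -/
def aA (K : Type*) [Field K] : AAlg K := RingQuot.mkAlgHom K (ARel K) (Agen K)

/-- The image of the generator `b` in `𝔸`. -/
def bA (K : Type*) [Field K] : AAlg K := RingQuot.mkAlgHom K (ARel K) (Bgen K)

/-- The commutator `c := a·b − b·a` in `𝔸`. -/
def cA (K : Type*) [Field K] : AAlg K := aA K * bA K - bA K * aA K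

/-- The `K`-span in `𝔸` of `{a, b} ∪ {c·aⁱ·bʲ : i + j odd}`. -/
def TSpan (K : Type*) [Field K] : Submodule K (AAlg K) :=
  Submodule.span K
    ({aA K, bA K} ∪ {w | ∃ i j : ℕ, Odd (i + j) ∧ w = cA K * (aA K) ^ i * (bA K) ^ j})

theorem a_mul_c (K : Type*) [Field K] : aA K * cA K = 0 := by
  have h := RingQuot.mkAlgHom_rel K (ARel.aab (K := K))
  simp only [map_mul] at h
  change aA K * aA K * bA K = aA K * bA K * aA K at h
  rw [cA, mul_sub, ← mul_assoc, ← mul_assoc, h, sub_self]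

theorem b_mul_c (K : Type*) [Field K] : bA K * cA K = 0 := by
  have h := RingQuot.mkAlgHom_rel K (ARel.bba (K := K))
  simp only [map_mul] at h
  change bA K * bA K * aA K = bA K * aA K * bA K at h
  rw [cA, mul_sub, ← mul_assoc, ← mul_assoc, h, sub_self]

theorem c_mul_c (K : Type*) [Field K] : cA K * cA K = 0 := by
  conv_lhs => enter [1]; rw [cA]
  rw [sub_mul, mul_assoc, mul_assoc, a_mul_c, b_mul_c, mul_zero, mul_zero, sub_self]

theorem mul_c_scalar (K : Type*) [Field K] (p : AAlg K) : ∃ k : K, p * cA K = k • cA K := by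
  obtain ⟨q, rfl⟩ := RingQuot.mkAlgHom_surjective K (ARel K) p
  induction q using FreeAlgebra.induction with
  | grade0 r => exact ⟨r, by rw [AlgHom.commutes, Algebra.smul_def]⟩
  | grade1 x =>
    refine ⟨0, ?_⟩
    rw [zero_smul]
    fin_cases x
    · exact a_mul_c K
    · exact b_mul_c K
  | mul x y hx hy =>
    obtain ⟨k, hk⟩ := hx
    obtain ⟨l, hl⟩ := hy
    exact ⟨l * k, by rw [map_mul, mul_assoc, hl, mul_smul_comm, hk, smul_smul]⟩
  | add x y hx hy =>
    obtain ⟨k, hk⟩ := hx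
    obtain ⟨l, hl⟩ := hy
    exact ⟨k + l, by rw [map_add, add_mul, hl, hk, add_smul]⟩

theorem c_mul_mul_c (K : Type*) [Field K] (p q : AAlg K) :
    cA K * p * (cA K * q) = 0 := by
  obtain ⟨k, hk⟩ := mul_c_scalar K p
  rw [← mul_assoc, mul_assoc (cA K), hk, mul_smul_comm, c_mul_c, smul_zero, zero_mul]

theorem T_form (K : Type*) [Field K] (t : AAlg K) (ht : t ∈ TSpan K) :
    ∃ (α β : K) (p : AAlg K), t = α • aA K + β • bA K + cA K * p := by
  induction ht using Submodule.span_induction with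
  | mem x hx =>
    rcases hx with (rfl | rfl) | ⟨i, j, -, rfl⟩
    · exact ⟨1, 0, 0, by simp⟩
    · exact ⟨0, 1, 0, by simp⟩
    · exact ⟨0, 0, aA K ^ i * bA K ^ j, by simp [mul_assoc]⟩
  | zero => exact ⟨0, 0, 0, by simp⟩
  | add x y _ _ hx hy =>
    obtain ⟨α, β, p, rfl⟩ := hx
    obtain ⟨α', β', p', rfl⟩ := hy
    exact ⟨α + α', β + β', p + p', by rw [add_smul, add_smul, mul_add]; abel⟩
  | smul k x _ hx =>
    obtain ⟨α, β, p, rfl⟩ := hx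
    exact ⟨k * α, k * β, k • p, by simp [smul_smul]⟩

theorem T_mul_c (K : Type*) [Field K] (t : AAlg K) (ht : t ∈ TSpan K) (y : AAlg K) :
    t * (cA K * y) = 0 := by
  obtain ⟨α, β, p, rfl⟩ := T_form K t ht
  rw [add_mul, c_mul_mul_c, add_mul, smul_mul_assoc, smul_mul_assoc, ← mul_assoc, ← mul_assoc,
    a_mul_c, b_mul_c]
  simp

theorem T_comm (K : Type*) [Field K] (t s : AAlg K) (ht : t ∈ TSpan K) (hs : s ∈ TSpan K) :
    ∃ y, t * s - s * t = cA K * y := by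
  have h1 := T_mul_c K t ht
  have h2 := T_mul_c K s hs
  obtain ⟨α, β, p, rfl⟩ := T_form K t ht
  obtain ⟨γ, δ, q, rfl⟩ := T_form K s hs
  refine ⟨(α * δ - β * γ) • 1 + p * (γ • aA K + δ • bA K) - q * (α • aA K + β • bA K), ?_⟩
  rw [mul_add _ _ (cA K * q), h1, mul_add _ _ (cA K * p), h2, add_zero, add_zero,
    add_mul _ (cA K * p), add_mul _ (cA K * q), mul_sub, mul_add (cA K), mul_assoc, mul_assoc]
  have : (α • aA K + β • bA K) * (γ • aA K + δ • bA K)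
      - (γ • aA K + δ • bA K) * (α • aA K + β • bA K) = cA K * ((α * δ - β * γ) • 1) := by
    rw [mul_smul_comm, mul_one, cA]
    simp only [mul_add, add_mul, smul_mul_assoc, mul_smul_comm, smul_add, smul_sub, smul_smul]
    module
  rw [← this]
  abel

/-- `[T,T,[T,T,T]] = 0` for the triple product `[x,y,z] := [[x,y],z]`. -/
theorem stmt_14 (K : Type*) [Field K] [CharZero K] :
    ∀ t₁ ∈ TSpan K, ∀ t₂ ∈ TSpan K, ∀ t₃ ∈ TSpan K, ∀ t₄ ∈ TSpan K, ∀ t₅ ∈ TSpan K,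
      (t₁ * t₂ - t₂ * t₁) * ((t₃ * t₄ - t₄ * t₃) * t₅ - t₅ * (t₃ * t₄ - t₄ * t₃))
        - ((t₃ * t₄ - t₄ * t₃) * t₅ - t₅ * (t₃ * t₄ - t₄ * t₃)) * (t₁ * t₂ - t₂ * t₁)
        = 0 := by
  intro t₁ h₁ t₂ h₂ t₃ h₃ t₄ h₄ t₅ h₅
  obtain ⟨y, hy⟩ := T_comm K t₁ t₂ h₁ h₂
  obtain ⟨z, hz⟩ := T_comm K t₃ t₄ h₃ h₄
  rw [hy, hz, T_mul_c K t₅ h₅, sub_zero, mul_assoc (cA K) z, c_mul_mul_c, c_mul_mul_c, sub_zero]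
end
end
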